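/- arXiv:1607.01302 — 2 statements merged into one kernel-verified Lean document; each statement's English description precedes it below -/
import Mathlib

section
/- Let (X, p) and (Y, q) be nonempty finite probability spaces with p and q of full support. Then there exists a map f : X → Y such that ∑_{y∈Y} max(0, f_*(p)_y − q_y) ≤ 2^{H₀(q) − H_∞(p)} (so that the total variation distance between f_*(p) and q is at most 2^{H₀(q) − H_∞(p)}), and such that for every y ∈ Y the fibre satisfies |f^{−1}(y)| ≤ 2^{H_{−∞}(p)}·(2^{−H_∞(q)} + 2^{−H_∞(p)}). -/
open scoped Classical

noncomputable section

/-- Min-entropy `H_∞(p) = -log₂ max_x p_x`. -/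
noncomputable def minEntropy {X : Type*} [Fintype X] [Nonempty X] (p : X → ℝ) : ℝ :=
  -Real.logb 2 (Finset.univ.sup' Finset.univ_nonempty p)

/-- Hartley entropy `H₀(p) = log₂ |{x : p_x > 0}|`. -/
noncomputable def hartleyEntropy {X : Type*} [Fintype X] (p : X → ℝ) : ℝ :=
  Real.logb 2 ((Finset.univ.filter (fun x => 0 < p x)).card)

/-- Rényi entropy at `-∞`: `H_{-∞}(p) = -log₂ min_x p_x`. -/
noncomputable def negInfEntropy {X : Type*} [Fintype X] [Nonempty X] (p : X → ℝ) : ℝ :=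
  -Real.logb 2 (Finset.univ.inf' Finset.univ_nonempty p)

/-- Greedy assignment: items of weight at most `M` and total weight at most that of the bins can be
distributed so that no bin `y` is filled beyond `q y + M`. -/
theorem exists_map_fiber_sum_le {X Y : Type*} [Fintype Y] [Nonempty Y]
    (p : X → ℝ) (q : Y → ℝ) (M : ℝ) (hM : 0 ≤ M) (hp : ∀ x, 0 < p x) (hpM : ∀ x, p x ≤ M)
    (hq : ∀ y, 0 ≤ q y) (S : Finset X) (hS : ∑ x ∈ S, p x ≤ ∑ y, q y) :
    ∃ f : X → Y, ∀ y, ∑ x ∈ S.filter (fun x => f x = y), p x ≤ q y + M := by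
  induction S using Finset.induction_on with
  | empty =>
    refine ⟨fun _ => Classical.arbitrary Y, fun y => ?_⟩
    simpa using add_nonneg (hq y) hM
  | insert a S ha ih =>
    rw [Finset.sum_insert ha] at hS
    have hlt : ∑ x ∈ S, p x < ∑ y, q y := by linarith [hp a]
    obtain ⟨f, hf⟩ := ih hlt.le
    rw [← Finset.sum_fiberwise S f p] at hlt
    obtain ⟨b, -, hb⟩ := Finset.exists_lt_of_sum_lt hlt
    refine ⟨Function.update f a b, fun y => ?_⟩
    have hcongr : S.filter (fun x => Function.update f a b x = y) = S.filter (fun x => f x = y) :=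
      Finset.filter_congr fun x hx => by
        rw [Function.update_of_ne (ne_of_mem_of_not_mem hx ha)]
    rw [Finset.filter_insert, hcongr, Function.update_self]
    split_ifs with h
    · subst h
      rw [Finset.sum_insert (by simp [ha])]
      linarith [hpM a]
    · exact hf y

theorem two_rpow_neg_minEntropy {X : Type*} [Fintype X] [Nonempty X] (p : X → ℝ)
    (hp : ∀ x, 0 < p x) :
    (2 : ℝ) ^ (-(minEntropy p)) = Finset.univ.sup' Finset.univ_nonempty p := by
  rw [minEntropy, neg_neg, Real.rpow_logb (by norm_num) (by norm_num)]
  exact (Finset.lt_sup'_iff _).2 ⟨Classical.arbitrary X, Finset.mem_univ _, hp _⟩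

theorem two_rpow_hartleyEntropy {X : Type*} [Fintype X] [Nonempty X] (p : X → ℝ)
    (hp : ∀ x, 0 < p x) :
    (2 : ℝ) ^ hartleyEntropy p = Fintype.card X := by
  rw [hartleyEntropy, Finset.filter_true_of_mem fun x _ => hp x, Finset.card_univ,
    Real.rpow_logb (by norm_num) (by norm_num) (by exact_mod_cast Fintype.card_pos)]

theorem two_rpow_negInfEntropy {X : Type*} [Fintype X] [Nonempty X] (p : X → ℝ)
    (hp : ∀ x, 0 < p x) :
    (2 : ℝ) ^ negInfEntropy p = (Finset.univ.inf' Finset.univ_nonempty p)⁻¹ := by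
  rw [negInfEntropy, Real.rpow_neg (by norm_num), Real.rpow_logb (by norm_num) (by norm_num)]
  exact (Finset.lt_inf'_iff _).2 fun x _ => hp x

/-- randomness-extraction / coarse-graining lemma. -/
theorem statement10 {X Y : Type*} [Fintype X] [Fintype Y] [Nonempty X] [Nonempty Y]
    (p : X → ℝ) (q : Y → ℝ) (hp : ∀ x, 0 < p x) (hq : ∀ y, 0 < q y)
    (hp1 : ∑ x, p x = 1) (hq1 : ∑ y, q y = 1) :
    ∃ f : X → Y,
      (∑ y, max 0 ((∑ x ∈ Finset.univ.filter (fun x => f x = y), p x) - q y)) ≤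
        (2 : ℝ) ^ (hartleyEntropy q - minEntropy p) ∧
      ∀ y, ((Finset.univ.filter (fun x => f x = y)).card : ℝ) ≤
        (2 : ℝ) ^ (negInfEntropy p) *
          ((2 : ℝ) ^ (-(minEntropy q)) + (2 : ℝ) ^ (-(minEntropy p))) := by
  have hpM : ∀ x, p x ≤ (2 : ℝ) ^ (-(minEntropy p)) := fun x => by
    rw [two_rpow_neg_minEntropy p hp]
    exact Finset.le_sup' p (Finset.mem_univ x)
  have hqM : ∀ y, q y ≤ (2 : ℝ) ^ (-(minEntropy q)) := fun y => by
    rw [two_rpow_neg_minEntropy q hq]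
    exact Finset.le_sup' q (Finset.mem_univ y)
  have hM : 0 ≤ (2 : ℝ) ^ (-(minEntropy p)) := by positivity
  obtain ⟨f, hf⟩ := exists_map_fiber_sum_le p q _ hM hp hpM (fun y => (hq y).le) Finset.univ
    (hp1.trans hq1.symm).le
  refine ⟨f, ?_, fun y => ?_⟩
  · rw [sub_eq_add_neg, Real.rpow_add two_pos, two_rpow_hartleyEntropy q hq, ← nsmul_eq_mul]
    exact Finset.sum_le_card_nsmul _ _ _ fun y _ => max_le hM (by linarith [hf y])
  · have hm : 0 < Finset.univ.inf' Finset.univ_nonempty p :=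
      (Finset.lt_inf'_iff _).2 fun x _ => hp x
    have hcard := Finset.card_nsmul_le_sum (Finset.univ.filter fun x => f x = y) p
      (Finset.univ.inf' Finset.univ_nonempty p)
      (fun x _ => Finset.inf'_le p (Finset.mem_univ x))
    rw [nsmul_eq_mul] at hcard
    rw [two_rpow_negInfEntropy p hp, ← div_eq_inv_mul, le_div_iff₀ hm]
    linarith [hf y, hqM y]
end
end

section
/- Let p = (p_1, …, p_d) be a probability distribution on {1, …, d} with all p_i > 0, and for n ≥ 2 let T_n ⊆ {1, …, d}^n be the strongly typical set of all sequences x whose letter counts n_i(x) satisfy (n − √(n·log n))·p_i ≤ n_i(x) ≤ (n + √(n·log n))·p_i for every i. Then the probability of T_n under the product distribution tends to one: p^{⊗n}(T_n) → 1 as n → ∞. -/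
open scoped Classical

noncomputable section

/-- Number of occurrences of the letter `i` in the sequence `x`. -/
def letterCount {d n : ℕ} (x : Fin n → Fin d) (i : Fin d) : ℕ :=
  (Finset.univ.filter (fun j => x j = i)).card

/-- The product weights of a weight of total mass one have total mass one. -/
lemma sum_prod_weight_eq_one {α : Type*} [Fintype α] (p : α → ℝ) (hp1 : ∑ a, p a = 1) (n : ℕ) :
    ∑ x : Fin n → α, ∏ j, p (x j) = 1 := by
  induction n with
  | zero => simp
  | succ n ih =>
    rw [← (Fin.consEquiv fun _ => α).sum_comp, Fintype.sum_prod_type]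
    simp [Fin.consEquiv, Fin.prod_univ_succ, ← Finset.mul_sum, ih, hp1]

/-- A sum of independent centred variables is centred. -/
lemma sum_prod_weight_mul_sum {α : Type*} [Fintype α] (p f : α → ℝ) (hp1 : ∑ a, p a = 1)
    (hf : ∑ a, p a * f a = 0) (n : ℕ) :
    ∑ x : Fin n → α, (∏ j, p (x j)) * ∑ j, f (x j) = 0 := by
  induction n with
  | zero => simp
  | succ n ih =>
    rw [← (Fin.consEquiv fun _ => α).sum_comp, Fintype.sum_prod_type]
    have h (a : α) (y : Fin n → α) :
        p a * (∏ j, p (y j)) * (f a + ∑ j, f (y j)) =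
          p a * f a * (∏ j, p (y j)) + p a * ((∏ j, p (y j)) * ∑ j, f (y j)) := by ring
    simp [Fin.consEquiv, Fin.prod_univ_succ, Fin.sum_univ_succ, h, Finset.sum_add_distrib,
      ← Finset.mul_sum, ih, sum_prod_weight_eq_one p hp1, hf]

/-- The variance of a sum of independent identically distributed centred variables. -/
lemma sum_prod_weight_mul_sum_sq {α : Type*} [Fintype α] (p f : α → ℝ) (hp1 : ∑ a, p a = 1)
    (hf : ∑ a, p a * f a = 0) (n : ℕ) :
    ∑ x : Fin n → α, (∏ j, p (x j)) * (∑ j, f (x j)) ^ 2 = n * ∑ a, p a * f a ^ 2 := by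
  induction n with
  | zero => simp
  | succ n ih =>
    rw [← (Fin.consEquiv fun _ => α).sum_comp, Fintype.sum_prod_type]
    have h (a : α) (y : Fin n → α) :
        p a * (∏ j, p (y j)) * (f a + ∑ j, f (y j)) ^ 2 =
          p a * f a ^ 2 * (∏ j, p (y j)) + 2 * (p a * f a) * ((∏ j, p (y j)) * ∑ j, f (y j))
            + p a * ((∏ j, p (y j)) * (∑ j, f (y j)) ^ 2) := by ring
    simp only [Fin.consEquiv, Equiv.coe_fn_mk, Fin.prod_univ_succ, Fin.sum_univ_succ,
      Fin.cons_zero, Fin.cons_succ, h, Finset.sum_add_distrib, ← Finset.mul_sum, ih,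
      sum_prod_weight_eq_one p hp1, sum_prod_weight_mul_sum p f hp1 hf, ← Finset.sum_mul, hp1]
    push_cast
    ring

/-- The variance of the number of occurrences of a letter. -/
lemma sum_prod_weight_mul_letterCount_sub_sq {d : ℕ} (p : Fin d → ℝ) (hp1 : ∑ i, p i = 1)
    (n : ℕ) (i : Fin d) :
    ∑ x : Fin n → Fin d, (∏ j, p (x j)) * ((letterCount x i : ℝ) - n * p i) ^ 2 =
      n * (p i * (1 - p i)) := by
  have key := sum_prod_weight_mul_sum_sq p (fun a => (if a = i then 1 else 0) - p i) hp1
    (by simp [mul_sub, Finset.sum_sub_distrib, ← Finset.sum_mul, hp1]) n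
  have h (a : Fin d) : p a * ((if a = i then 1 else 0) - p i) ^ 2 =
      (if a = i then p a * (1 - 2 * p i) else 0) + p a * p i ^ 2 := by
    split_ifs <;> ring
  simp only [h, Finset.sum_add_distrib, ← Finset.sum_mul, hp1, Finset.sum_ite_eq',
    Finset.mem_univ, if_true] at key
  calc _ = _ := by
        refine Finset.sum_congr rfl fun x _ => ?_
        simp [letterCount, Finset.sum_sub_distrib]
    _ = _ := key
    _ = _ := by ring

/-- Chebyshev's inequality for the letter counts, with a union bound over the letters. -/
lemma one_sub_le_sum_prod_weight_typical {d : ℕ} (p : Fin d → ℝ) (hp : ∀ i, 0 < p i)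
    (hp1 : ∑ i, p i = 1) (n : ℕ) {t : ℝ} (ht : 0 < t) :
    1 - n * (∑ i, (1 - p i) / p i) / t ^ 2 ≤
      ∑ x ∈ Finset.univ.filter (fun x : Fin n → Fin d => ∀ i : Fin d,
        ((n : ℝ) - t) * p i ≤ (letterCount x i : ℝ) ∧
        (letterCount x i : ℝ) ≤ ((n : ℝ) + t) * p i), ∏ j, p (x j) := by
  have hmean : ∑ x : Fin n → Fin d, (∏ j, p (x j)) *
      (1 - ∑ i, ((letterCount x i : ℝ) - n * p i) ^ 2 / (t * p i) ^ 2) =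
      1 - n * (∑ i, (1 - p i) / p i) / t ^ 2 := by
    simp only [mul_sub, mul_one, Finset.sum_sub_distrib, sum_prod_weight_eq_one p hp1,
      Finset.mul_sum, Finset.sum_div]
    rw [Finset.sum_comm]
    congr 1
    refine Finset.sum_congr rfl fun i _ => ?_
    simp only [← mul_div_assoc]
    rw [← Finset.sum_div, sum_prod_weight_mul_letterCount_sub_sq p hp1]
    have := (hp i).ne'
    field_simp
  rw [← hmean, Finset.sum_filter]
  refine Finset.sum_le_sum fun x _ => ?_
  have hP : 0 ≤ ∏ j, p (x j) := Finset.prod_nonneg fun j _ => (hp _).le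
  have hterm (i : Fin d) : 0 ≤ ((letterCount x i : ℝ) - n * p i) ^ 2 / (t * p i) ^ 2 := by
    positivity
  split_ifs with hx
  · exact mul_le_of_le_one_right hP (sub_le_self _ (Finset.sum_nonneg fun i _ => hterm i))
  · refine mul_nonpos_of_nonneg_of_nonpos hP (sub_nonpos.2 ?_)
    obtain ⟨i, hi⟩ := not_forall.1 hx
    refine le_trans ?_ (Finset.single_le_sum (fun i _ => hterm i) (Finset.mem_univ i))
    have htp : 0 < t * p i := mul_pos ht (hp i)
    rw [one_le_div (by positivity), sq_le_sq, abs_of_pos htp]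
    by_contra! hlt
    rw [abs_lt] at hlt
    exact hi ⟨by linarith [hlt.1], by linarith [hlt.2]⟩

open Filter in
/-- the strongly typical set carries asymptotically all the probability. -/
theorem statement12 {d : ℕ} (p : Fin d → ℝ) (hp : ∀ i, 0 < p i) (hp1 : ∑ i, p i = 1) :
    Tendsto
      (fun n : ℕ =>
        ∑ x ∈ Finset.univ.filter (fun x : Fin n → Fin d => ∀ i : Fin d,
          ((n : ℝ) - Real.sqrt ((n : ℝ) * Real.log (n : ℝ))) * p i ≤ (letterCount x i : ℝ) ∧
          (letterCount x i : ℝ) ≤ ((n : ℝ) + Real.sqrt ((n : ℝ) * Real.log (n : ℝ))) * p i),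
          ∏ j, p (x j))
      atTop (nhds 1) := by
  have hlim : Tendsto (fun n : ℕ => 1 - (∑ i, (1 - p i) / p i) / Real.log (n : ℝ))
      atTop (nhds 1) := by
    simpa using ((Real.tendsto_log_atTop.comp tendsto_natCast_atTop_atTop).const_div_atTop
      (∑ i, (1 - p i) / p i)).const_sub (1 : ℝ)
  refine tendsto_of_tendsto_of_tendsto_of_le_of_le' hlim tendsto_const_nhds ?_ ?_
  · filter_upwards [eventually_ge_atTop 2] with n hn
    have hn0 : (0 : ℝ) < n := by positivity
    have hlog : 0 < Real.log n := Real.log_pos (by exact_mod_cast hn)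
    have hpos : 0 < (n : ℝ) * Real.log n := mul_pos hn0 hlog
    have h := one_sub_le_sum_prod_weight_typical p hp hp1 n (Real.sqrt_pos.2 hpos)
    rwa [Real.sq_sqrt hpos.le, mul_div_mul_left _ _ hn0.ne'] at h
  · refine Eventually.of_forall fun n => ?_
    rw [← sum_prod_weight_eq_one p hp1 n]
    exact Finset.sum_le_sum_of_subset_of_nonneg (Finset.filter_subset _ _)
      fun x _ _ => Finset.prod_nonneg fun j _ => (hp _).le
end
end
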